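/- arXiv:2511.02790 — 2 statements merged into one kernel-verified Lean document; each statement's English description precedes it below -/
import Mathlib

section
/- Let g ≥ 3 and C > 0. There is a constant c = c(C,g) > 0 such that for all integers a_0 ≥ 1 and a_1, …, a_{g−2} ≥ 0 with a_0 ≥ a_s for every s = 1, …, g−2, and every integer ν with |ν| ≤ C·a_0^{1/4}, one has |Ψ(a; ν) − Ψ(a; 0)| ≤ c · ν² a_0^{−3/2}, where a = (a_0, …, a_{g−2}). -/
set_option autoImplicit false

noncomputable section

open scoped Classical

/-- `P(T,j)`: the probability that `T` independent uniform random variables on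
`{0,…,g-1} - (g-1)/2` sum to `j`. -/
def Pg (g T : ℕ) (j : ℝ) : ℝ :=
  ((Finset.univ.filter
      (fun y : Fin T → Fin g => ∑ i, ((y i : ℕ) : ℝ) = j + T * ((g : ℝ) - 1) / 2)).card : ℝ)
    / g ^ T

/-- `e_{g-1}(x) = exp(2πix/(g-1))`. -/
def egC (g : ℕ) (x : ℝ) : ℂ := Complex.exp (2 * Real.pi * Complex.I * x / ((g : ℝ) - 1))

/-- `Ψ(a; ν) = Σ_{j₁,…,j_{g-2}} ∏_{s=0}^{g-2} e_{g-1}(s jₛ) P(aₛ, jₛ)`, where the sum is over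
`jₛ` with `jₛ + aₛ(g-1)/2 ∈ {0,…,aₛ(g-1)}` for `s = 1,…,g-2` (parametrised by
`yₛ := jₛ + aₛ(g-1)/2`), and `j₀ := ν - (j₁ + … + j_{g-2})`. -/
def Psi (g : ℕ) (a : ℕ → ℕ) (ν : ℝ) : ℂ :=
  ∑ y ∈ Fintype.piFinset (fun t : Fin (g - 2) => Finset.range (a ((t : ℕ) + 1) * (g - 1) + 1)),
    (∏ t : Fin (g - 2),
        egC g ((((t : ℕ) + 1 : ℕ) : ℝ) *
            ((y t : ℝ) - (a ((t : ℕ) + 1) : ℝ) * ((g : ℝ) - 1) / 2)) *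
          ((Pg g (a ((t : ℕ) + 1))
              ((y t : ℝ) - (a ((t : ℕ) + 1) : ℝ) * ((g : ℝ) - 1) / 2) : ℝ) : ℂ)) *
      ((Pg g (a 0)
          (ν - ∑ t : Fin (g - 2), ((y t : ℝ) - (a ((t : ℕ) + 1) : ℝ) * ((g : ℝ) - 1) / 2)) :
        ℝ) : ℂ)

/-- The characteristic function of the uniform distribution on `{0,…,g-1} - (g-1)/2`. -/
def uniformCharFn (g : ℕ) (θ : ℝ) : ℂ :=
  (∑ k : Fin g, Complex.exp (Complex.I * (θ * (((k : ℕ) : ℝ) - ((g : ℝ) - 1) / 2) : ℝ))) / g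

lemma norm_cexp_sub_cexp_le (x y : ℝ) :
    ‖Complex.exp (Complex.I * x) - Complex.exp (Complex.I * y)‖ ≤ |x - y| := by
  have h : Complex.exp (Complex.I * x) - Complex.exp (Complex.I * y) =
      Complex.exp (Complex.I * y) * (Complex.exp (Complex.I * ((x - y : ℝ) : ℂ)) - 1) := by
    rw [mul_sub, ← Complex.exp_add]
    push_cast
    ring_nf
  rw [h, norm_mul, Complex.norm_exp_I_mul_ofReal, one_mul]
  exact Real.norm_exp_I_mul_ofReal_sub_one_le

lemma integral_cexp_int_mul (n : ℤ) :
    ∫ θ in (-Real.pi)..Real.pi, Complex.exp (Complex.I * (θ * (n : ℝ) : ℝ)) =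
      if n = 0 then 2 * (Real.pi : ℂ) else 0 := by
  split_ifs with h
  · subst h
    simp
    ring
  · have hc : Complex.I * (n : ℂ) ≠ 0 := by simp [h]
    have : ∀ θ : ℝ, Complex.exp (Complex.I * (θ * (n : ℝ) : ℝ)) =
        Complex.exp ((Complex.I * n) * θ) := by
      intro θ
      push_cast
      ring_nf
    simp_rw [this]
    rw [integral_exp_mul_complex hc]
    have : Complex.exp (Complex.I * n * Real.pi) =
        Complex.exp (Complex.I * n * (-Real.pi : ℝ)) := by
      rw [Complex.exp_eq_exp_iff_exists_int]
      exact ⟨n, by push_cast; ring⟩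
    rw [this, sub_self, zero_div]

lemma continuous_uniformCharFn (g : ℕ) : Continuous (uniformCharFn g) := by
  unfold uniformCharFn
  fun_prop

lemma uniformCharFn_neg (g : ℕ) (θ : ℝ) : uniformCharFn g (-θ) = uniformCharFn g θ := by
  unfold uniformCharFn
  congr 1
  rw [← Equiv.sum_comp Fin.revPerm]
  refine Finset.sum_congr rfl fun k _ => ?_
  have hk : ((Fin.revPerm k : Fin g) : ℕ) = g - (k + 1) := by simp [Fin.val_rev]
  rw [hk, Nat.cast_sub (by omega)]
  congr 3
  push_cast
  ring

lemma norm_uniformCharFn_le_one {g : ℕ} (hg : 0 < g) (θ : ℝ) : ‖uniformCharFn g θ‖ ≤ 1 := by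
  have hg' : (0 : ℝ) < g := by exact_mod_cast hg
  rw [uniformCharFn, norm_div, Complex.norm_natCast, div_le_one hg']
  refine (norm_sum_le _ _).trans ?_
  simp only [Complex.norm_exp_I_mul_ofReal]
  simp

lemma norm_uniformCharFn_sub_le {g : ℕ} (hg : 0 < g) (x y : ℝ) :
    ‖uniformCharFn g x - uniformCharFn g y‖ ≤ g * |x - y| := by
  have hg' : (0 : ℝ) < g := by exact_mod_cast hg
  rw [uniformCharFn, uniformCharFn, ← sub_div, norm_div, Complex.norm_natCast, div_le_iff₀ hg',
    ← Finset.sum_sub_distrib]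
  refine (norm_sum_le _ _).trans ?_
  have : ∀ k ∈ (Finset.univ : Finset (Fin g)),
      ‖Complex.exp (Complex.I * (x * (((k : ℕ) : ℝ) - ((g : ℝ) - 1) / 2) : ℝ)) -
        Complex.exp (Complex.I * (y * (((k : ℕ) : ℝ) - ((g : ℝ) - 1) / 2) : ℝ))‖ ≤
      g * |x - y| := by
    intro k _
    refine (norm_cexp_sub_cexp_le _ _).trans ?_
    rw [← sub_mul, abs_mul, mul_comm]
    gcongr
    have h1 : ((k : ℕ) : ℝ) + 1 ≤ g := by exact_mod_cast k.2
    have h2 : (0 : ℝ) ≤ ((k : ℕ) : ℝ) := by positivity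
    rw [abs_le]
    constructor <;> linarith
  refine (Finset.sum_le_card_nsmul _ _ _ this).trans ?_
  simp only [Finset.card_univ, Fintype.card_fin, nsmul_eq_mul]
  linarith

lemma norm_uniformCharFn_eq_inv {g : ℕ} (hg : 3 ≤ g) {s : ℕ} (hs : 1 ≤ s) (hs' : s ≤ g - 2) :
    ‖uniformCharFn g (2 * Real.pi * s / ((g : ℝ) - 1))‖ = 1 / g := by
  obtain ⟨m, rfl⟩ : ∃ m, g = m + 1 := ⟨g - 1, by omega⟩
  have hm : m ≠ 0 := by omega
  have hmC : (m : ℂ) ≠ 0 := by exact_mod_cast hm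
  set ζ : ℂ := Complex.exp (2 * Real.pi * Complex.I * (s / m)) with hζ
  have hζ1 : ζ ^ m = 1 := by
    rw [hζ, ← Complex.exp_nat_mul, Complex.exp_eq_one_iff]
    exact ⟨s, by push_cast; field_simp⟩
  have hζne : ζ ≠ 1 := by
    rw [hζ, Ne, Complex.exp_eq_one_iff]
    rintro ⟨n, hn⟩
    have h2 : (2 * Real.pi * Complex.I : ℂ) ≠ 0 := Complex.two_pi_I_ne_zero
    have h3 : (s : ℂ) / m = n := by
      apply mul_left_cancel₀ h2
      rw [hn]; ring
    rw [div_eq_iff hmC] at h3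
    have h4 : (s : ℤ) = n * m := by exact_mod_cast h3
    have h5 : (m : ℤ) ∣ s := ⟨n, by rw [h4]; ring⟩
    have h6 := Nat.le_of_dvd (by omega) (Int.natCast_dvd_natCast.mp h5)
    omega
  have key : uniformCharFn (m + 1) (2 * Real.pi * s / (((m + 1 : ℕ) : ℝ) - 1)) =
      Complex.exp (Complex.I * (-(Real.pi * s) : ℝ)) * (∑ k ∈ Finset.range (m + 1), ζ ^ k) /
        (m + 1 : ℕ) := by
    rw [uniformCharFn, Finset.mul_sum, Finset.sum_range]
    congr 1
    refine Finset.sum_congr rfl fun k _ => ?_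
    rw [hζ, ← Complex.exp_nat_mul, ← Complex.exp_add]
    congr 1
    push_cast
    rw [add_sub_cancel_right]
    field_simp
    ring
  have hsum : ∑ k ∈ Finset.range (m + 1), ζ ^ k = 1 := by
    rw [Finset.sum_range_succ, hζ1, geom_sum_eq hζne, hζ1]
    simp
  rw [key, hsum, mul_one, norm_div, Complex.norm_exp_I_mul_ofReal, Complex.norm_natCast]

lemma norm_uniformCharFn_le_exp {g : ℕ} (hg : 2 ≤ g) {θ : ℝ} (hθ : |θ| ≤ Real.pi) :
    ‖uniformCharFn g θ‖ ≤ Real.exp (-(1 / (g * Real.pi ^ 2)) * θ ^ 2) := by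
  obtain ⟨m, rfl⟩ : ∃ m, g = m + 2 := ⟨g - 2, by omega⟩
  have hg' : (0 : ℝ) < ((m + 2 : ℕ) : ℝ) := by positivity
  have hcos0 : 0 ≤ Real.cos (θ / 2) := by
    apply Real.cos_nonneg_of_neg_pi_div_two_le_of_le <;> linarith [abs_le.mp hθ]
  have hcos : Real.cos (θ / 2) ≤ 1 - 2 / Real.pi ^ 2 * (θ / 2) ^ 2 := by
    apply Real.cos_le_one_sub_mul_cos_sq
    rw [abs_div, abs_two]
    linarith [abs_nonneg θ]
  have h2 : ∀ c : ℝ, ‖Complex.exp (Complex.I * (θ * (0 - c) : ℝ)) +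
      Complex.exp (Complex.I * (θ * (1 - c) : ℝ))‖ = 2 * Real.cos (θ / 2) := by
    intro c
    have : Complex.exp (Complex.I * (θ * (0 - c) : ℝ)) +
        Complex.exp (Complex.I * (θ * (1 - c) : ℝ)) =
        Complex.exp (Complex.I * (θ * (1 / 2 - c) : ℝ)) * ((2 * Real.cos (θ / 2) : ℝ) : ℂ) := by
      push_cast
      rw [Complex.cos, mul_div_cancel₀ _ two_ne_zero, mul_add, ← Complex.exp_add,
        ← Complex.exp_add, add_comm]
      ring_nf
    rw [this, norm_mul, Complex.norm_exp_I_mul_ofReal, one_mul, Complex.norm_real,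
      Real.norm_of_nonneg (by positivity)]
  have h3 : ‖uniformCharFn (m + 2) θ‖ ≤ 1 + -(1 / ((m + 2 : ℕ) * Real.pi ^ 2)) * θ ^ 2 := by
    rw [uniformCharFn, norm_div, Complex.norm_natCast, div_le_iff₀ hg', Fin.sum_univ_succ,
      Fin.sum_univ_succ, ← add_assoc]
    have h4 : ‖∑ i : Fin m, Complex.exp (Complex.I *
        (θ * (((i.succ.succ : Fin (m + 2)) : ℕ) - (((m + 2 : ℕ) : ℝ) - 1) / 2) : ℝ))‖ ≤ m := by
      refine (norm_sum_le _ _).trans ?_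
      simp only [Complex.norm_exp_I_mul_ofReal]
      simp
    refine (norm_add_le _ _).trans ((add_le_add (le_of_eq ?_) h4).trans
      (b := 2 * Real.cos (θ / 2) + m) ?_)
    · rw [← h2 ((((m + 2 : ℕ) : ℝ) - 1) / 2)]
      simp
    · have : (1 + -(1 / ((m + 2 : ℕ) * Real.pi ^ 2)) * θ ^ 2) * ((m + 2 : ℕ) : ℝ) =
          ((m + 2 : ℕ) : ℝ) - θ ^ 2 / Real.pi ^ 2 := by
        field_simp
        ring
      rw [this]
      have h5 : 2 / Real.pi ^ 2 * (θ / 2) ^ 2 = θ ^ 2 / Real.pi ^ 2 / 2 := by ring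
      push_cast
      linarith
  refine h3.trans ?_
  rw [add_comm]
  exact Real.add_one_le_exp _

lemma norm_pow_sub_pow_le {x y : ℂ} {r : ℝ} (hx : ‖x‖ ≤ 1) (hy : ‖y‖ ≤ r) (hr : r < 1) (n : ℕ) :
    ‖x ^ n - y ^ n‖ ≤ (1 - r)⁻¹ * ‖x - y‖ := by
  have hr0 : 0 ≤ r := (norm_nonneg y).trans hy
  rw [← geom_sum₂_mul, norm_mul]
  gcongr
  calc ‖∑ i ∈ Finset.range n, x ^ i * y ^ (n - 1 - i)‖
      ≤ ∑ i ∈ Finset.range n, r ^ (n - 1 - i) := by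
        refine norm_sum_le_of_le _ fun i _ => ?_
        rw [norm_mul, norm_pow, norm_pow]
        calc ‖x‖ ^ i * ‖y‖ ^ (n - 1 - i) ≤ 1 * r ^ (n - 1 - i) := by
              gcongr
              exact pow_le_one₀ (norm_nonneg _) hx
          _ = _ := one_mul _
    _ = ∑ i ∈ Finset.range n, r ^ i := Finset.sum_range_reflect (fun i => r ^ i) n
    _ ≤ (1 - r)⁻¹ := by
        rw [← tsum_geometric_of_lt_one hr0 hr]
        exact (summable_geometric_of_lt_one hr0 hr).sum_le_tsum _ fun i _ => by positivity

lemma norm_prod_sub_prod_le_sum {ι : Type*} (s : Finset ι) (f h : ι → ℂ)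
    (hf : ∀ i, ‖f i‖ ≤ 1) (hh : ∀ i, ‖h i‖ ≤ 1) :
    ‖∏ i ∈ s, f i - ∏ i ∈ s, h i‖ ≤ ∑ i ∈ s, ‖f i - h i‖ := by
  induction s using Finset.induction_on with
  | empty => simp
  | insert i s hi ih =>
    rw [Finset.prod_insert hi, Finset.prod_insert hi, Finset.sum_insert hi]
    have hprod : ‖∏ j ∈ s, h j‖ ≤ 1 := by
      rw [norm_prod]
      exact Finset.prod_le_one (fun _ _ => norm_nonneg _) fun j _ => hh j
    have : f i * ∏ j ∈ s, f j - h i * ∏ j ∈ s, h j =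
        (f i - h i) * ∏ j ∈ s, h j + f i * (∏ j ∈ s, f j - ∏ j ∈ s, h j) := by ring
    rw [this]
    refine (norm_add_le _ _).trans (add_le_add ?_ ?_)
    · rw [norm_mul]
      exact mul_le_of_le_one_right (norm_nonneg _) hprod
    · rw [norm_mul]
      exact (mul_le_of_le_one_left (norm_nonneg _) (hf i)).trans ih

lemma uniformCharFn_pow (g T : ℕ) (θ : ℝ) :
    uniformCharFn g θ ^ T = (∑ y : Fin T → Fin g,
      Complex.exp (Complex.I * (θ * (∑ i, ((y i : ℕ) : ℝ) - T * ((g : ℝ) - 1) / 2) : ℝ))) /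
        g ^ T := by
  rw [uniformCharFn, div_pow, Fintype.sum_pow]
  congr 1
  refine Finset.sum_congr rfl fun y _ => ?_
  rw [← Complex.exp_sum]
  congr 1
  rw [← Finset.mul_sum, ← Complex.ofReal_sum, ← Finset.mul_sum, Finset.sum_sub_distrib]
  simp
  left
  ring

lemma uniformCharFn_pow_eq_sum_Pg (g T : ℕ) (θ : ℝ) :
    uniformCharFn g θ ^ T = ∑ n ∈ Finset.range (T * (g - 1) + 1),
      Complex.exp (Complex.I * (θ * ((n : ℝ) - T * ((g : ℝ) - 1) / 2) : ℝ)) *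
        ((Pg g T ((n : ℝ) - T * ((g : ℝ) - 1) / 2) : ℝ) : ℂ) := by
  have hmaps : ∀ y ∈ (Finset.univ : Finset (Fin T → Fin g)),
      ∑ i, (y i : ℕ) ∈ Finset.range (T * (g - 1) + 1) := by
    intro y _
    rw [Finset.mem_range, Nat.lt_succ_iff]
    refine (Finset.sum_le_card_nsmul _ _ (g - 1) fun i _ => by omega).trans ?_
    simp
  rw [uniformCharFn_pow, ← Finset.sum_fiberwise_of_maps_to hmaps, Finset.sum_div]
  refine Finset.sum_congr rfl fun n _ => ?_
  have hfilter : (Finset.univ.filter fun y : Fin T → Fin g => ∑ i, ((y i : ℕ) : ℝ) =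
      (n : ℝ) - T * ((g : ℝ) - 1) / 2 + T * ((g : ℝ) - 1) / 2) =
      Finset.univ.filter fun y : Fin T → Fin g => ∑ i, (y i : ℕ) = n := by
    ext y
    simp only [Finset.mem_filter, Finset.mem_univ, true_and, sub_add_cancel]
    exact_mod_cast Iff.rfl
  have hconst : ∀ y ∈ Finset.univ.filter fun y : Fin T → Fin g => ∑ i, (y i : ℕ) = n,
      Complex.exp (Complex.I * (θ * (∑ i, ((y i : ℕ) : ℝ) - T * ((g : ℝ) - 1) / 2) : ℝ)) =
      Complex.exp (Complex.I * (θ * ((n : ℝ) - T * ((g : ℝ) - 1) / 2) : ℝ)) := by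
    intro y hy
    rw [← Nat.cast_sum, (Finset.mem_filter.mp hy).2]
  rw [Finset.sum_congr rfl hconst, Finset.sum_const, nsmul_eq_mul, Pg, hfilter]
  push_cast
  ring

lemma Pg_eq_zero {g T : ℕ} {j : ℝ} (hj : ∀ n : ℤ, j + T * ((g : ℝ) - 1) / 2 ≠ n) :
    Pg g T j = 0 := by
  rw [Pg, Finset.filter_eq_empty_iff.mpr, Finset.card_empty, Nat.cast_zero, zero_div]
  intro y _ hy
  exact hj (∑ i, (y i : ℕ) : ℕ) (by rw [← hy]; push_cast; rfl)

lemma Pg_eq_integral {g T : ℕ} {j : ℝ} {n : ℤ} (hj : j + T * ((g : ℝ) - 1) / 2 = n) :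
    ((Pg g T j : ℝ) : ℂ) = (2 * Real.pi : ℂ)⁻¹ * ∫ θ in (-Real.pi)..Real.pi,
      uniformCharFn g θ ^ T * Complex.exp (Complex.I * (θ * (-j) : ℝ)) := by
  have hpi : (2 * Real.pi : ℂ) ≠ 0 := by simp [Real.pi_ne_zero]
  have hint : ∀ θ : ℝ, uniformCharFn g θ ^ T * Complex.exp (Complex.I * (θ * (-j) : ℝ)) =
      ((g : ℂ) ^ T)⁻¹ * ∑ y : Fin T → Fin g, Complex.exp
        (Complex.I * (θ * (((∑ i, (y i : ℕ) : ℕ) - n : ℤ) : ℝ) : ℝ)) := by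
    intro θ
    rw [uniformCharFn_pow, div_eq_inv_mul, mul_assoc, Finset.sum_mul]
    congr 1
    refine Finset.sum_congr rfl fun y _ => ?_
    rw [← Complex.exp_add, ← mul_add, ← Complex.ofReal_add]
    congr 3
    rw [Int.cast_sub, ← hj]
    push_cast
    ring
  simp_rw [hint]
  rw [intervalIntegral.integral_const_mul, intervalIntegral.integral_finsetSum]
  · simp_rw [integral_cexp_int_mul]
    rw [← Finset.sum_filter, Finset.sum_const, nsmul_eq_mul, Pg, hj]
    have hfilter : (Finset.univ.filter fun y : Fin T → Fin g =>
        ((∑ i, (y i : ℕ) : ℕ) - n : ℤ) = 0) =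
        Finset.univ.filter fun y : Fin T → Fin g => ∑ i, ((y i : ℕ) : ℝ) = n := by
      ext y
      simp only [Finset.mem_filter, Finset.mem_univ, true_and, sub_eq_zero]
      rw [← Nat.cast_sum]
      exact_mod_cast Iff.rfl
    rw [hfilter]
    push_cast
    field_simp
  · intro y _
    apply Continuous.intervalIntegrable
    fun_prop

/-- The product of the characteristic function factors with `s = 1,…,g-2`, which are shifted by
`2πs/(g-1)`. -/
def shiftedCharFnProd (g : ℕ) (a : ℕ → ℕ) (θ : ℝ) : ℂ :=
  ∏ t : Fin (g - 2),
    uniformCharFn g (θ + 2 * Real.pi * (((t : ℕ) + 1 : ℕ) : ℝ) / ((g : ℝ) - 1)) ^ a ((t : ℕ) + 1)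

lemma continuous_shiftedCharFnProd (g : ℕ) (a : ℕ → ℕ) : Continuous (shiftedCharFnProd g a) := by
  unfold shiftedCharFnProd
  have := continuous_uniformCharFn g
  fun_prop

lemma norm_shiftedCharFnProd_le_one {g : ℕ} (hg : 0 < g) (a : ℕ → ℕ) (θ : ℝ) :
    ‖shiftedCharFnProd g a θ‖ ≤ 1 := by
  rw [shiftedCharFnProd, norm_prod]
  refine Finset.prod_le_one (fun _ _ => norm_nonneg _) fun t _ => ?_
  rw [norm_pow]
  exact pow_le_one₀ (norm_nonneg _) (norm_uniformCharFn_le_one hg _)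

lemma norm_shiftedCharFnProd_sub_le {g : ℕ} (hg : 3 ≤ g) (a : ℕ → ℕ) (θ : ℝ) :
    ‖shiftedCharFnProd g a θ - shiftedCharFnProd g a 0‖ ≤ 3 * (g : ℝ) ^ 2 * |θ| := by
  have hle : ∀ (x : ℝ) (n : ℕ), ‖uniformCharFn g x ^ n‖ ≤ 1 := by
    intro x n
    rw [norm_pow]
    exact pow_le_one₀ (norm_nonneg _) (norm_uniformCharFn_le_one (by omega) _)
  have hg3 : (3 : ℝ) ≤ g := by exact_mod_cast hg
  rw [shiftedCharFnProd, shiftedCharFnProd]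
  refine (norm_prod_sub_prod_le_sum _ _ _ (fun _ => hle _ _) (fun _ => hle _ _)).trans ?_
  have hterm : ∀ t ∈ (Finset.univ : Finset (Fin (g - 2))),
      ‖uniformCharFn g (θ + 2 * Real.pi * (((t : ℕ) + 1 : ℕ) : ℝ) / ((g : ℝ) - 1)) ^
          a ((t : ℕ) + 1) -
        uniformCharFn g (0 + 2 * Real.pi * (((t : ℕ) + 1 : ℕ) : ℝ) / ((g : ℝ) - 1)) ^
          a ((t : ℕ) + 1)‖ ≤ 3 * (g * |θ|) := by
    intro t _
    have hy : ‖uniformCharFn g (0 + 2 * Real.pi * (((t : ℕ) + 1 : ℕ) : ℝ) / ((g : ℝ) - 1))‖ ≤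
        1 / 3 := by
      rw [zero_add, norm_uniformCharFn_eq_inv hg (by omega) (by omega)]
      gcongr
    refine (norm_pow_sub_pow_le (norm_uniformCharFn_le_one (by omega) _) hy (by norm_num) _).trans
      (mul_le_mul (by norm_num) ?_ (norm_nonneg _) (by norm_num))
    refine (norm_uniformCharFn_sub_le (by omega) _ _).trans_eq ?_
    rw [add_sub_add_right_eq_sub, sub_zero]
  refine (Finset.sum_le_card_nsmul _ _ _ hterm).trans ?_
  rw [Finset.card_univ, Fintype.card_fin, nsmul_eq_mul]
  have h1 : ((g - 2 : ℕ) : ℝ) ≤ g := by exact_mod_cast Nat.sub_le _ _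
  calc ((g - 2 : ℕ) : ℝ) * (3 * (g * |θ|)) ≤ g * (3 * (g * |θ|)) := by gcongr
    _ = _ := by ring

lemma Psi_eq_integral {g : ℕ} {a : ℕ → ℕ} {N : ℤ}
    (hN : (a 0 : ℝ) * ((g : ℝ) - 1) / 2 +
      ∑ t : Fin (g - 2), (a ((t : ℕ) + 1) : ℝ) * ((g : ℝ) - 1) / 2 = N) (ν : ℤ) :
    Psi g a ν = (2 * Real.pi : ℂ)⁻¹ * ∫ θ in (-Real.pi)..Real.pi,
      uniformCharFn g θ ^ a 0 * shiftedCharFnProd g a θ *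
        Complex.exp (Complex.I * (θ * (-ν) : ℝ)) := by
  have hprod : ∀ θ : ℝ, uniformCharFn g θ ^ a 0 * shiftedCharFnProd g a θ *
        Complex.exp (Complex.I * (θ * (-ν) : ℝ)) =
      ∑ y ∈ Fintype.piFinset
          (fun t : Fin (g - 2) => Finset.range (a ((t : ℕ) + 1) * (g - 1) + 1)),
        (∏ t : Fin (g - 2),
          egC g ((((t : ℕ) + 1 : ℕ) : ℝ) *
              ((y t : ℝ) - (a ((t : ℕ) + 1) : ℝ) * ((g : ℝ) - 1) / 2)) *
            ((Pg g (a ((t : ℕ) + 1))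
                ((y t : ℝ) - (a ((t : ℕ) + 1) : ℝ) * ((g : ℝ) - 1) / 2) : ℝ) : ℂ)) *
        (uniformCharFn g θ ^ a 0 * Complex.exp (Complex.I * (θ *
          (-((ν : ℝ) - ∑ t : Fin (g - 2),
            ((y t : ℝ) - (a ((t : ℕ) + 1) : ℝ) * ((g : ℝ) - 1) / 2))) : ℝ))) := by
    intro θ
    simp_rw [shiftedCharFnProd, uniformCharFn_pow_eq_sum_Pg _ (a (_ + 1))]
    rw [Finset.prod_univ_sum, Finset.mul_sum, Finset.sum_mul]
    refine Finset.sum_congr rfl fun y _ => ?_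
    have hexp : ∀ t : Fin (g - 2),
        Complex.exp (Complex.I *
          ((θ + 2 * Real.pi * (((t : ℕ) + 1 : ℕ) : ℝ) / ((g : ℝ) - 1)) *
            ((y t : ℝ) - (a ((t : ℕ) + 1) : ℝ) * ((g : ℝ) - 1) / 2) : ℝ)) =
        Complex.exp (Complex.I *
          (θ * ((y t : ℝ) - (a ((t : ℕ) + 1) : ℝ) * ((g : ℝ) - 1) / 2) : ℝ)) *
        egC g ((((t : ℕ) + 1 : ℕ) : ℝ) *
              ((y t : ℝ) - (a ((t : ℕ) + 1) : ℝ) * ((g : ℝ) - 1) / 2)) := by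
      intro t
      rw [egC, ← Complex.exp_add]
      congr 1
      push_cast
      ring
    simp_rw [hexp, mul_assoc]
    rw [Finset.prod_mul_distrib, ← Complex.exp_sum, ← Finset.mul_sum, ← Complex.ofReal_sum,
      ← Finset.mul_sum, neg_sub, sub_eq_add_neg _ (ν : ℝ), mul_add θ, Complex.ofReal_add,
      mul_add Complex.I, Complex.exp_add]
    ring
  simp_rw [hprod]
  rw [intervalIntegral.integral_finsetSum, Finset.mul_sum, Psi]
  · refine Finset.sum_congr rfl fun y _ => ?_
    rw [intervalIntegral.integral_const_mul, mul_left_comm]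
    congr 1
    refine Pg_eq_integral (n := ν - ∑ t, (y t : ℤ) + N) ?_
    rw [Finset.sum_sub_distrib]
    push_cast
    rw [← hN]
    ring
  · intro y _
    apply Continuous.intervalIntegrable
    have := continuous_uniformCharFn g
    fun_prop

lemma Psi_eq_zero {g : ℕ} {a : ℕ → ℕ}
    (hN : ∀ N : ℤ, (a 0 : ℝ) * ((g : ℝ) - 1) / 2 +
      ∑ t : Fin (g - 2), (a ((t : ℕ) + 1) : ℝ) * ((g : ℝ) - 1) / 2 ≠ N) (ν : ℤ) :
    Psi g a ν = 0 := by
  refine Finset.sum_eq_zero fun y _ => ?_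
  rw [Pg_eq_zero, Complex.ofReal_zero, mul_zero]
  intro n hn
  apply hN (n - ν + ∑ t, (y t : ℤ))
  rw [Finset.sum_sub_distrib] at hn
  push_cast
  rw [← hn]
  ring

lemma norm_cexp_symm_sub_two_le (x : ℝ) :
    ‖Complex.exp (Complex.I * x) + Complex.exp (Complex.I * (-x : ℝ)) - 2‖ ≤ x ^ 2 := by
  have : Complex.exp (Complex.I * x) + Complex.exp (Complex.I * (-x : ℝ)) - 2 =
      ((2 * Real.cos x - 2 : ℝ) : ℂ) := by
    push_cast
    rw [Complex.cos]
    ring_nf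
  rw [this, Complex.norm_real, Real.norm_eq_abs, abs_le]
  constructor <;>
    nlinarith [Real.one_sub_sq_div_two_le_cos (x := x), Real.cos_le_one x, sq_nonneg x]

lemma integral_sq_mul_exp_neg_mul_sq_le {b : ℝ} (hb : 0 < b) {A : ℝ} (hA : 0 < A) :
    ∫ θ in (-Real.pi)..Real.pi, θ ^ 2 * Real.exp (-b * θ ^ 2) ^ A ≤
      (∫ u : ℝ, u ^ 2 * Real.exp (-b * u ^ 2)) * A ^ (-(3 : ℝ) / 2) := by
  have hint : MeasureTheory.Integrable fun u : ℝ => u ^ 2 * Real.exp (-b * u ^ 2) := by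
    simpa using integrable_rpow_mul_exp_neg_mul_sq hb (s := 2) (by norm_num)
  have hs : 0 < √A := Real.sqrt_pos.mpr hA
  have heq : ∀ θ : ℝ, θ ^ 2 * Real.exp (-b * θ ^ 2) ^ A =
      A⁻¹ * ((√A * θ) ^ 2 * Real.exp (-b * (√A * θ) ^ 2)) := by
    intro θ
    rw [← Real.exp_mul, mul_pow, Real.sq_sqrt hA.le]
    field_simp
  simp_rw [heq]
  rw [intervalIntegral.integral_const_mul,
    intervalIntegral.integral_of_le (by linarith [Real.pi_pos])]
  have hle := MeasureTheory.setIntegral_le_integral (s := Set.Ioc (-Real.pi) Real.pi)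
    (hint.comp_mul_left' hs.ne') (Filter.Eventually.of_forall fun θ => by positivity)
  rw [MeasureTheory.Measure.integral_comp_mul_left
    (fun u => u ^ 2 * Real.exp (-b * u ^ 2))] at hle
  have hpow : A ^ (-(3 : ℝ) / 2) = A⁻¹ * (√A)⁻¹ := by
    rw [Real.sqrt_eq_rpow, ← Real.rpow_neg hA.le, ← Real.rpow_neg_one, ← Real.rpow_add hA]
    norm_num
  rw [abs_of_pos (by positivity), smul_eq_mul] at hle
  rw [hpow, mul_left_comm, mul_comm _ (√A)⁻¹]
  gcongr

lemma norm_symm_integrand_le {G : ℝ → ℂ} {K : ℝ} (hG0 : ‖G 0‖ ≤ 1)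
    (hG : ∀ θ, ‖G θ - G 0‖ ≤ K * |θ|) (ν : ℤ) (θ : ℝ) :
    ‖G θ * (Complex.exp (Complex.I * (θ * (-ν) : ℝ)) - 1) +
      G (-θ) * (Complex.exp (Complex.I * (-θ * (-ν) : ℝ)) - 1)‖ ≤
      (2 * K + 1) * (ν : ℝ) ^ 2 * θ ^ 2 := by
  have hK : 0 ≤ K := by simpa using (norm_nonneg _).trans (hG 1)
  have hν : |(ν : ℝ)| ≤ (ν : ℝ) ^ 2 := by
    rw [← sq_abs]
    exact_mod_cast Int.le_self_sq |ν|
  have hb : ∀ x : ℝ, ‖Complex.exp (Complex.I * (x * (-ν) : ℝ)) - 1‖ ≤ |x| * (ν : ℝ) ^ 2 := by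
    intro x
    refine Real.norm_exp_I_mul_ofReal_sub_one_le.trans ?_
    rw [Real.norm_eq_abs, abs_mul, abs_neg]
    gcongr
  have hp : ∀ x : ℝ, ‖(G x - G 0) * (Complex.exp (Complex.I * (x * (-ν) : ℝ)) - 1)‖ ≤
      K * (ν : ℝ) ^ 2 * x ^ 2 := by
    intro x
    rw [norm_mul]
    refine (mul_le_mul (hG x) (hb x) (norm_nonneg _) (by positivity)).trans_eq ?_
    rw [← sq_abs x]
    ring
  have hsplit : G θ * (Complex.exp (Complex.I * (θ * (-ν) : ℝ)) - 1) +
      G (-θ) * (Complex.exp (Complex.I * (-θ * (-ν) : ℝ)) - 1) =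
      (G θ - G 0) * (Complex.exp (Complex.I * (θ * (-ν) : ℝ)) - 1) +
      (G (-θ) - G 0) * (Complex.exp (Complex.I * (-θ * (-ν) : ℝ)) - 1) +
      G 0 * (Complex.exp (Complex.I * (θ * (-ν) : ℝ)) +
        Complex.exp (Complex.I * (-(θ * (-ν)) : ℝ)) - 2) := by
    rw [neg_mul]
    ring
  have h0 : ‖G 0 * (Complex.exp (Complex.I * (θ * (-ν) : ℝ)) +
        Complex.exp (Complex.I * (-(θ * (-ν)) : ℝ)) - 2)‖ ≤ (θ * (-ν)) ^ 2 := by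
    rw [norm_mul]
    exact (mul_le_of_le_one_left (norm_nonneg _) hG0).trans (norm_cexp_symm_sub_two_le _)
  rw [hsplit]
  refine (norm_add₃_le).trans ?_
  have h1 := hp θ
  have h2 := hp (-θ)
  rw [neg_sq] at h2
  linarith

theorem statement12 (g : ℕ) (hg : 3 ≤ g) (C : ℝ) (hC : 0 < C) :
    ∃ c : ℝ, 0 < c ∧ ∀ a : ℕ → ℕ, 1 ≤ a 0 →
      (∀ s : ℕ, 1 ≤ s → s ≤ g - 2 → a s ≤ a 0) →
      ∀ ν : ℤ, |(ν : ℝ)| ≤ C * (a 0 : ℝ) ^ ((1 : ℝ) / 4) →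
        ‖Psi g a (ν : ℝ) - Psi g a 0‖ ≤ c * (ν : ℝ) ^ 2 * (a 0 : ℝ) ^ (-(3 : ℝ) / 2) := by
  have hg0 : (0 : ℝ) < g := by exact_mod_cast (by omega : 0 < g)
  have hpi := Real.pi_pos
  set b : ℝ := 1 / (g * Real.pi ^ 2) with hb
  have hb0 : 0 < b := by positivity
  set M : ℝ := ∫ u : ℝ, u ^ 2 * Real.exp (-b * u ^ 2) with hM
  have hM0 : 0 ≤ M := MeasureTheory.integral_nonneg fun u => by positivity
  set K : ℝ := 2 * (3 * (g : ℝ) ^ 2) + 1 with hK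
  refine ⟨(2 * Real.pi)⁻¹ * (2⁻¹ * (K * (M + 1))), by positivity, ?_⟩
  intro a ha _ ν _
  have ha0 : (0 : ℝ) < a 0 := by exact_mod_cast ha
  by_cases hN : ∃ N : ℤ, (a 0 : ℝ) * ((g : ℝ) - 1) / 2 +
      ∑ t : Fin (g - 2), (a ((t : ℕ) + 1) : ℝ) * ((g : ℝ) - 1) / 2 = N
  swap
  · push Not at hN
    have h0 := Psi_eq_zero hN 0
    rw [Int.cast_zero] at h0
    rw [Psi_eq_zero hN ν, h0, sub_zero, norm_zero]
    positivity
  obtain ⟨N, hN⟩ := hN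
  have hφ := continuous_uniformCharFn g
  have hG := continuous_shiftedCharFnProd g a
  set h : ℝ → ℂ := fun θ => uniformCharFn g θ ^ a 0 * (shiftedCharFnProd g a θ *
    (Complex.exp (Complex.I * (θ * (-ν) : ℝ)) - 1)) with hh
  have hcont : Continuous h := by fun_prop
  have hdiff : Psi g a ν - Psi g a 0 =
      (2 * Real.pi : ℂ)⁻¹ * ∫ θ in (-Real.pi)..Real.pi, h θ := by
    have h0 := Psi_eq_integral hN 0
    rw [Int.cast_zero] at h0
    rw [Psi_eq_integral hN ν, h0, ← mul_sub, ← intervalIntegral.integral_sub]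
    · congr 2
      funext θ
      simp only [hh, neg_zero, mul_zero, Complex.ofReal_zero, Complex.exp_zero]
      ring
    all_goals
      apply Continuous.intervalIntegrable
      fun_prop
  have hsymm : ∫ θ in (-Real.pi)..Real.pi, h θ =
      2⁻¹ * ∫ θ in (-Real.pi)..Real.pi, (h θ + h (-θ)) := by
    have hneg : Continuous fun θ => h (-θ) := hcont.comp continuous_neg
    rw [intervalIntegral.integral_add (hcont.intervalIntegrable _ _)
      (hneg.intervalIntegrable _ _), intervalIntegral.integral_comp_neg,
      neg_neg]
    ring
  have hbound : ∀ θ ∈ Set.Icc (-Real.pi) Real.pi, ‖h θ + h (-θ)‖ ≤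
      K * (ν : ℝ) ^ 2 * (θ ^ 2 * Real.exp (-b * θ ^ 2) ^ (a 0 : ℝ)) := by
    intro θ hθ
    simp only [hh]
    rw [uniformCharFn_neg, ← mul_add, norm_mul, norm_pow, Real.rpow_natCast]
    have h1 := norm_uniformCharFn_le_exp (g := g) (by omega) (abs_le.mpr hθ)
    have h2 := norm_symm_integrand_le (norm_shiftedCharFnProd_le_one (by omega) a 0)
      (norm_shiftedCharFnProd_sub_le hg a) ν θ
    refine (mul_le_mul (pow_le_pow_left₀ (norm_nonneg _) h1 _) h2 (norm_nonneg _)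
      (by positivity)).trans_eq ?_
    ring
  have hint : ‖∫ θ in (-Real.pi)..Real.pi, (h θ + h (-θ))‖ ≤
      K * (ν : ℝ) ^ 2 * (M * (a 0 : ℝ) ^ (-(3 : ℝ) / 2)) := by
    refine (intervalIntegral.norm_integral_le_of_norm_le (by linarith)
      (Filter.Eventually.of_forall fun θ hθ => hbound θ (Set.Ioc_subset_Icc_self hθ)) ?_).trans ?_
    · apply Continuous.intervalIntegrable
      simp_rw [Real.rpow_natCast]
      fun_prop
    · rw [intervalIntegral.integral_const_mul]
      gcongr
      exact integral_sq_mul_exp_neg_mul_sq_le hb0 ha0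
  have hnorm : ‖(2 * Real.pi : ℂ)⁻¹‖ = (2 * Real.pi)⁻¹ := by
    rw [norm_inv, norm_mul, Complex.norm_ofNat, Complex.norm_real, Real.norm_of_nonneg hpi.le]
  rw [hdiff, hsymm, norm_mul, norm_mul, hnorm, norm_inv, Complex.norm_ofNat]
  calc (2 * Real.pi)⁻¹ * (2⁻¹ * ‖∫ θ in (-Real.pi)..Real.pi, (h θ + h (-θ))‖)
      ≤ (2 * Real.pi)⁻¹ * (2⁻¹ *
          (K * (ν : ℝ) ^ 2 * ((M + 1) * (a 0 : ℝ) ^ (-(3 : ℝ) / 2)))) := by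
        gcongr
        refine hint.trans ?_
        gcongr
        linarith
    _ = _ := by ring
end
end

section
/- Let g ≥ 3 and C > 0. There is a constant c = c(C,g) > 0 such that the following holds. Let a = (a_0, …, a_{g−2}) be a tuple of non-negative integers with a_0 ≥ 1 and a_0 ≥ a_i for every i, let m be an integer with 0 ≤ m ≤ C·a_0^{1/4}, and let t be an integer with 1 ≤ t ≤ g−2. Let a′ be the tuple obtained from a by replacing a_t with a_t + m. Then Ψ(a′; 0) ≤ g^{−m} + c · m² a_0^{−3/2}. -/
set_option autoImplicit false

noncomputable section

open scoped Classical

/-- The characteristic function of the uniform distribution on `{0,…,g-1} - (g-1)/2`. -/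
def uniformChar (g : ℕ) (x : ℝ) : ℝ :=
  (∑ k : Fin g, Real.cos ((((k : ℕ) : ℝ) - ((g : ℝ) - 1) / 2) * x)) / g

lemma continuous_uniformChar (g : ℕ) : Continuous (uniformChar g) := by
  unfold uniformChar
  fun_prop

lemma uniformChar_neg (g : ℕ) (x : ℝ) : uniformChar g (-x) = uniformChar g x := by
  simp [uniformChar]

lemma abs_uniformChar_le_one (g : ℕ) (x : ℝ) : |uniformChar g x| ≤ 1 := by
  unfold uniformChar
  rw [abs_div, Nat.abs_cast]
  refine div_le_one_of_le₀ ((Finset.abs_sum_le_sum_abs _ _).trans ?_) (Nat.cast_nonneg _)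
  refine (Finset.sum_le_sum fun k _ => Real.abs_cos_le_one _).trans ?_
  simp

lemma uniformChar_add_two_pi {g : ℕ} (hg : 1 ≤ g) (x : ℝ) :
    uniformChar g (x + 2 * Real.pi) = (-1) ^ (g - 1) * uniformChar g x := by
  unfold uniformChar
  rw [← mul_div_assoc, Finset.mul_sum]
  congr 1
  refine Finset.sum_congr rfl fun k _ => ?_
  have h : (((k : ℕ) : ℝ) - ((g : ℝ) - 1) / 2) * (x + 2 * Real.pi)
      = (((k : ℕ) : ℝ) - ((g : ℝ) - 1) / 2) * x + (k : ℕ) * (2 * Real.pi)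
        - ((g - 1 : ℕ) : ℝ) * Real.pi := by
    push_cast [Nat.cast_sub hg]
    ring
  rw [h, Real.cos_sub_nat_mul_pi, Real.cos_add_nat_mul_two_pi]

lemma sum_sin_centered (g : ℕ) (x : ℝ) :
    ∑ k : Fin g, Real.sin ((((k : ℕ) : ℝ) - ((g : ℝ) - 1) / 2) * x) = 0 := by
  have h : ∑ k : Fin g, Real.sin ((((k : ℕ) : ℝ) - ((g : ℝ) - 1) / 2) * x)
      = -∑ k : Fin g, Real.sin ((((k : ℕ) : ℝ) - ((g : ℝ) - 1) / 2) * x) := by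
    conv_lhs => rw [← Equiv.sum_comp Fin.revPerm]
    rw [← Finset.sum_neg_distrib]
    refine Finset.sum_congr rfl fun k _ => ?_
    rw [← Real.sin_neg]
    congr 1
    rw [Fin.revPerm_apply, Fin.val_rev, Nat.cast_sub (by omega)]
    push_cast
    ring
  linarith

lemma sum_cexp_centered (g : ℕ) (hg : 1 ≤ g) (x : ℝ) :
    ∑ k : Fin g, Complex.exp (((((k : ℕ) : ℝ) - ((g : ℝ) - 1) / 2) * x : ℝ) * Complex.I)
      = g * (uniformChar g x : ℂ) := by
  have hg' : (g : ℝ) ≠ 0 := by positivity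
  have h1 : ∀ k : Fin g,
      Complex.exp (((((k : ℕ) : ℝ) - ((g : ℝ) - 1) / 2) * x : ℝ) * Complex.I)
      = (Real.cos ((((k : ℕ) : ℝ) - ((g : ℝ) - 1) / 2) * x) : ℂ)
        + (Real.sin ((((k : ℕ) : ℝ) - ((g : ℝ) - 1) / 2) * x) : ℂ) * Complex.I := by
    intro k
    rw [Complex.exp_mul_I, Complex.ofReal_cos, Complex.ofReal_sin]
  simp_rw [h1]
  rw [Finset.sum_add_distrib, ← Finset.sum_mul, ← Complex.ofReal_sum, ← Complex.ofReal_sum,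
    sum_sin_centered]
  rw [← Complex.ofReal_natCast, ← Complex.ofReal_mul, uniformChar, mul_div_cancel₀ _ hg']
  simp

lemma uniformChar_pow (g : ℕ) (hg : 1 ≤ g) (T : ℕ) (x : ℝ) :
    (uniformChar g x : ℂ) ^ T
      = (∑ v : Fin T → Fin g,
          Complex.exp (((∑ i, ((v i : ℕ) : ℝ) - T * ((g : ℝ) - 1) / 2) * x : ℝ) * Complex.I))
        / g ^ T := by
  have hg' : (g : ℂ) ≠ 0 := by
    have : g ≠ 0 := by omega
    exact_mod_cast this
  rw [eq_div_iff (pow_ne_zero _ hg'), ← mul_pow, mul_comm, ← sum_cexp_centered g hg,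
    Fintype.sum_pow]
  refine Finset.sum_congr rfl fun v _ => ?_
  rw [← Complex.exp_sum, ← Finset.sum_mul, ← Complex.ofReal_sum, ← Finset.sum_mul,
    Finset.sum_sub_distrib]
  simp [mul_div_assoc]

lemma sum_cexp_mul_Pg (g : ℕ) (hg : 1 ≤ g) (T : ℕ) (x : ℝ) :
    ∑ y ∈ Finset.range (T * (g - 1) + 1),
      Complex.exp ((((y : ℝ) - T * ((g : ℝ) - 1) / 2) * x : ℝ) * Complex.I)
        * ((Pg g T ((y : ℝ) - T * ((g : ℝ) - 1) / 2) : ℝ) : ℂ)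
      = (uniformChar g x : ℂ) ^ T := by
  rw [uniformChar_pow g hg, ← Finset.sum_fiberwise_of_maps_to
    (s := Finset.univ) (t := Finset.range (T * (g - 1) + 1))
    (g := fun v : Fin T → Fin g => ∑ i, (v i : ℕ)), Finset.sum_div]
  · refine Finset.sum_congr rfl fun y _ => ?_
    have hfil : (Finset.univ.filter (fun v : Fin T → Fin g =>
        ∑ i, ((v i : ℕ) : ℝ) = ((y : ℝ) - T * ((g : ℝ) - 1) / 2) + T * ((g : ℝ) - 1) / 2))
        = Finset.univ.filter (fun v : Fin T → Fin g => ∑ i, (v i : ℕ) = y) := by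
      refine Finset.filter_congr fun v _ => ?_
      rw [sub_add_cancel]
      exact_mod_cast Iff.rfl
    rw [Pg, hfil]
    rw [Finset.sum_congr rfl (g := fun _ =>
      Complex.exp ((((y : ℝ) - T * ((g : ℝ) - 1) / 2) * x : ℝ) * Complex.I))]
    · simp
      ring
    · intro v hv
      rw [Finset.mem_filter] at hv
      rw [← hv.2]
      simp
  · intro v _
    rw [Finset.mem_range, Nat.lt_succ_iff]
    refine (Finset.sum_le_card_nsmul _ _ (g - 1) fun i _ => by omega).trans ?_
    simp

lemma integral_cexp_half_int (r : ℝ) (n : ℤ) (hr : 2 * r = n) :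
    ∫ x in (-(2 * Real.pi))..(2 * Real.pi), Complex.exp ((r * x : ℝ) * Complex.I)
      = if r = 0 then 4 * (Real.pi : ℂ) else 0 := by
  split_ifs with h
  · simp [h]
    ring
  · have hc : (r : ℂ) * Complex.I ≠ 0 := by simp [h]
    have h1 : ∀ x : ℝ, Complex.exp ((r * x : ℝ) * Complex.I)
        = Complex.exp (((r : ℂ) * Complex.I) * x) := by
      intro x
      push_cast
      ring_nf
    simp_rw [h1]
    rw [integral_exp_mul_complex hc, div_eq_zero_iff]
    left
    rw [sub_eq_zero, Complex.exp_eq_exp_iff_exists_int]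
    refine ⟨n, ?_⟩
    have : (n : ℂ) = 2 * (r : ℂ) := by exact_mod_cast hr.symm
    rw [this]
    push_cast
    ring

lemma integral_cexp_mul_uniformChar_pow (g : ℕ) (hg : 1 ≤ g) (T : ℕ) (j : ℝ) (n : ℤ)
    (hj : 2 * j = n) :
    ∫ x in (-(2 * Real.pi))..(2 * Real.pi),
        Complex.exp (((-j) * x : ℝ) * Complex.I) * (uniformChar g x : ℂ) ^ T
      = 4 * Real.pi * (Pg g T j : ℝ) := by
  have h1 : ∀ x : ℝ, Complex.exp (((-j) * x : ℝ) * Complex.I) * (uniformChar g x : ℂ) ^ T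
      = ∑ v : Fin T → Fin g, Complex.exp
        (((∑ i, ((v i : ℕ) : ℝ) - T * ((g : ℝ) - 1) / 2 - j) * x : ℝ) * Complex.I) / g ^ T := by
    intro x
    rw [uniformChar_pow g hg, ← mul_div_assoc, Finset.mul_sum, ← Finset.sum_div]
    congr 1
    refine Finset.sum_congr rfl fun v _ => ?_
    rw [← Complex.exp_add]
    congr 1
    push_cast
    ring
  simp_rw [h1]
  rw [intervalIntegral.integral_finsetSum]
  swap
  · intro v _
    apply Continuous.intervalIntegrable
    fun_prop
  have h2 : ∀ v : Fin T → Fin g,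
      ∫ x in (-(2 * Real.pi))..(2 * Real.pi), Complex.exp
        (((∑ i, ((v i : ℕ) : ℝ) - T * ((g : ℝ) - 1) / 2 - j) * x : ℝ) * Complex.I) / g ^ T
      = if ∑ i, ((v i : ℕ) : ℝ) = j + T * ((g : ℝ) - 1) / 2
          then 4 * (Real.pi : ℂ) / g ^ T else 0 := by
    intro v
    rw [intervalIntegral.integral_div, integral_cexp_half_int _
      (2 * ∑ i, ((v i : ℕ) : ℤ) - T * ((g : ℤ) - 1) - n)]
    · have : ∑ i, ((v i : ℕ) : ℝ) - T * ((g : ℝ) - 1) / 2 - j = 0 ↔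
          ∑ i, ((v i : ℕ) : ℝ) = j + T * ((g : ℝ) - 1) / 2 := by
        constructor <;> intro h <;> linarith
      simp only [this]
      split_ifs <;> simp
    · push_cast
      linarith
  simp_rw [h2]
  rw [← Finset.sum_filter, Finset.sum_const, Pg]
  simp
  ring

lemma egC_mul_cexp (g s : ℕ) (j x : ℝ) :
    egC g ((s : ℝ) * j) * Complex.exp ((j * x : ℝ) * Complex.I)
      = Complex.exp ((j * (x + 2 * Real.pi * s / ((g : ℝ) - 1)) : ℝ) * Complex.I) := by
  rw [egC, ← Complex.exp_add]
  congr 1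
  push_cast
  ring

/-- Fourier integral representation of `Ψ(a; 0)`. -/
lemma Psi_eq_integral_s13 (g : ℕ) (hg : 1 ≤ g) (a : ℕ → ℕ) :
    4 * Real.pi * Psi g a 0
      = ((∫ x in (-(2 * Real.pi))..(2 * Real.pi), uniformChar g x ^ a 0 *
          ∏ t : Fin (g - 2), uniformChar g
            (x + 2 * Real.pi * ((t : ℕ) + 1 : ℕ) / ((g : ℝ) - 1)) ^ a ((t : ℕ) + 1) : ℝ) : ℂ) := by
  rw [← intervalIntegral.integral_ofReal]
  have hexp : ∀ x : ℝ, ((uniformChar g x ^ a 0 *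
          ∏ t : Fin (g - 2), uniformChar g
            (x + 2 * Real.pi * ((t : ℕ) + 1 : ℕ) / ((g : ℝ) - 1)) ^ a ((t : ℕ) + 1) : ℝ) : ℂ)
      = ∑ y ∈ Fintype.piFinset
          (fun t : Fin (g - 2) => Finset.range (a ((t : ℕ) + 1) * (g - 1) + 1)),
        (∏ t : Fin (g - 2),
          egC g ((((t : ℕ) + 1 : ℕ) : ℝ) *
            ((y t : ℝ) - (a ((t : ℕ) + 1) : ℝ) * ((g : ℝ) - 1) / 2)) *
          ((Pg g (a ((t : ℕ) + 1))
              ((y t : ℝ) - (a ((t : ℕ) + 1) : ℝ) * ((g : ℝ) - 1) / 2) : ℝ) : ℂ)) *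
        (Complex.exp (((-(0 - ∑ t : Fin (g - 2),
            ((y t : ℝ) - (a ((t : ℕ) + 1) : ℝ) * ((g : ℝ) - 1) / 2))) * x : ℝ) * Complex.I)
          * (uniformChar g x : ℂ) ^ a 0) := by
    intro x
    rw [Complex.ofReal_mul, Complex.ofReal_prod]
    simp_rw [Complex.ofReal_pow]
    simp_rw [← sum_cexp_mul_Pg g hg (a (_ + 1))]
    rw [Finset.prod_univ_sum, Finset.mul_sum]
    refine Finset.sum_congr rfl fun y _ => ?_
    rw [zero_sub, neg_neg, Finset.sum_mul, Complex.ofReal_sum, Finset.sum_mul, Complex.exp_sum]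
    rw [← mul_assoc, ← Finset.prod_mul_distrib, mul_comm]
    congr 1
    refine Finset.prod_congr rfl fun t _ => ?_
    rw [← egC_mul_cexp]
    ring
  simp_rw [hexp]
  rw [intervalIntegral.integral_finsetSum]
  swap
  · intro y _
    apply Continuous.intervalIntegrable
    have := continuous_uniformChar g
    fun_prop
  rw [Psi, Finset.mul_sum]
  refine Finset.sum_congr rfl fun y _ => ?_
  rw [intervalIntegral.integral_const_mul, integral_cexp_mul_uniformChar_pow g hg _ _
    (-∑ t : Fin (g - 2), (2 * (y t : ℤ) - (a ((t : ℕ) + 1) : ℤ) * ((g : ℤ) - 1)))]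
  · ring
  · push_cast
    rw [zero_sub, mul_neg, Finset.mul_sum]
    congr 1
    refine Finset.sum_congr rfl fun t _ => ?_
    ring

lemma abs_uniformChar_le_exp (g : ℕ) (hg : 2 ≤ g) (x : ℝ) (hx : |x| ≤ Real.pi) :
    |uniformChar g x| ≤ Real.exp (-(1 / (g * Real.pi ^ 2)) * x ^ 2) := by
  obtain ⟨n, rfl⟩ := Nat.exists_eq_add_of_le' hg
  have hpi := Real.pi_pos
  have hcos : 0 ≤ Real.cos (x / 2) := by
    apply Real.cos_nonneg_of_neg_pi_div_two_le_of_le <;> linarith [abs_le.1 hx]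
  have hq : Real.cos (x / 2) ≤ 1 - 2 / Real.pi ^ 2 * (x / 2) ^ 2 := by
    apply Real.cos_le_one_sub_mul_cos_sq
    rw [abs_div, abs_two]
    linarith
  have hn : (0 : ℝ) < ((n + 2 : ℕ) : ℝ) := by positivity
  have hsum : |∑ k : Fin (n + 2),
      Real.cos ((((k : ℕ) : ℝ) - (((n + 2 : ℕ) : ℝ) - 1) / 2) * x)|
      ≤ 2 * Real.cos (x / 2) + n := by
    rw [Fin.sum_univ_succ, Fin.sum_univ_succ, ← add_assoc]
    refine (abs_add_le _ _).trans (add_le_add ?_ ?_)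
    · rw [Real.cos_add_cos, abs_mul, abs_mul, abs_two]
      have h2 : |Real.cos ((((((0 : Fin (n + 2)) : ℕ) : ℝ) - (((n + 2 : ℕ) : ℝ) - 1) / 2) * x
          - (((((0 : Fin (n + 1)).succ : ℕ) : ℝ) - (((n + 2 : ℕ) : ℝ) - 1) / 2) * x)) / 2)|
          = Real.cos (x / 2) := by
        rw [← abs_of_nonneg hcos, ← Real.cos_neg (x / 2)]
        congr 2
        simp
        ring
      rw [h2]
      have := Real.abs_cos_le_one ((((((0 : Fin (n + 2)) : ℕ) : ℝ)
          - (((n + 2 : ℕ) : ℝ) - 1) / 2) * x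
          + (((((0 : Fin (n + 1)).succ : ℕ) : ℝ) - (((n + 2 : ℕ) : ℝ) - 1) / 2) * x)) / 2)
      nlinarith
    · refine (Finset.abs_sum_le_sum_abs _ _).trans ?_
      refine (Finset.sum_le_sum fun k _ => Real.abs_cos_le_one _).trans ?_
      simp
  have hle : |uniformChar (n + 2) x| ≤ -(1 / (((n + 2 : ℕ) : ℝ) * Real.pi ^ 2)) * x ^ 2 + 1 := by
    rw [uniformChar, abs_div, Nat.abs_cast, div_le_iff₀ hn]
    refine hsum.trans ?_
    have : (-(1 / (((n + 2 : ℕ) : ℝ) * Real.pi ^ 2)) * x ^ 2 + 1) * ((n + 2 : ℕ) : ℝ)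
        = 2 * (1 - 2 / Real.pi ^ 2 * (x / 2) ^ 2) + n := by
      field_simp
      push_cast
      ring
    rw [this]
    linarith
  exact hle.trans (Real.add_one_le_exp _)

lemma abs_uniformChar_root_of_unity (g : ℕ) (hg : 2 ≤ g) (s : ℕ) (h1 : 1 ≤ s) (h2 : s < g - 1) :
    |uniformChar g (2 * Real.pi * s / ((g : ℝ) - 1))| = 1 / g := by
  set x := 2 * Real.pi * s / ((g : ℝ) - 1) with hx
  have hgpos : (0 : ℝ) < g := by positivity
  have hsub : ((g - 1 : ℕ) : ℝ) = (g : ℝ) - 1 := by rw [Nat.cast_sub (by omega)]; simp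
  have hprim := Complex.isPrimitiveRoot_exp (g - 1) (by omega)
  set ζ := Complex.exp (2 * Real.pi * Complex.I / ((g - 1 : ℕ) : ℂ)) with hζ
  have hne : ζ ^ s ≠ 1 := hprim.pow_ne_one_of_pos_of_lt (by omega) h2
  have hexp : ∀ k : ℕ, Complex.exp ((((k : ℝ) - ((g : ℝ) - 1) / 2) * x : ℝ) * Complex.I)
      = Complex.exp ((-(((g : ℝ) - 1) / 2 * x) : ℝ) * Complex.I) * (ζ ^ s) ^ k := by
    intro k
    rw [hζ, ← Complex.exp_nat_mul, ← Complex.exp_nat_mul, ← Complex.exp_add, hx,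
      ← Complex.ofReal_natCast (g - 1), hsub]
    congr 1
    push_cast
    ring
  have hgeom : ∑ k ∈ Finset.range g, (ζ ^ s) ^ k = 1 := by
    obtain ⟨n, rfl⟩ := Nat.exists_eq_add_of_le' (show 1 ≤ g by omega)
    simp only [Nat.add_sub_cancel] at *
    have h0 : (ζ ^ s) ^ n = 1 := by rw [← pow_mul, mul_comm, pow_mul, hprim.pow_eq_one, one_pow]
    rw [Finset.sum_range_succ, geom_sum_eq hne, h0]
    simp
  have h := sum_cexp_centered g (by omega) x
  simp_rw [hexp] at h
  rw [← Finset.mul_sum, Fin.sum_univ_eq_sum_range (fun k => (ζ ^ s) ^ k), hgeom, mul_one] at h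
  have h' := congrArg norm h
  rw [Complex.norm_exp_ofReal_mul_I, norm_mul, Complex.norm_natCast, Complex.norm_real,
    Real.norm_eq_abs] at h'
  field_simp
  linarith

lemma abs_sin_sub_self_le (h : ℝ) (hh : |h| ≤ 1) : |Real.sin h - h| ≤ h ^ 2 / 4 := by
  have key : ∀ u : ℝ, 0 ≤ u → u ≤ 1 → |Real.sin u - u| ≤ u ^ 2 / 4 := by
    intro u h0 h1
    rcases h0.eq_or_lt with rfl | hpos
    · simp
    · have := Real.sin_gt_sub_cube hpos
      have := Real.sin_lt hpos
      rw [abs_le]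
      constructor <;> nlinarith [sq_nonneg u, mul_nonneg (sq_nonneg u) (sub_nonneg.2 h1)]
  rcases le_total 0 h with h0 | h0
  · exact key h h0 (le_of_abs_le hh)
  · have := key (-h) (by linarith) (by linarith [abs_le.1 hh])
    rw [Real.sin_neg, ← abs_neg] at this
    convert this using 2 <;> ring

lemma abs_cos_add_sub_le (u h : ℝ) (hh : |h| ≤ 1) :
    |Real.cos (u + h) - Real.cos u - (-Real.sin u) * h| ≤ h ^ 2 := by
  have h1 := abs_sin_sub_self_le h hh
  have h2 : |Real.cos h - 1| ≤ h ^ 2 / 2 := by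
    rw [abs_le]
    constructor <;> nlinarith [Real.one_sub_sq_div_two_le_cos (x := h), Real.cos_le_one h]
  have h3 : Real.cos (u + h) - Real.cos u - (-Real.sin u) * h
      = Real.cos u * (Real.cos h - 1) - Real.sin u * (Real.sin h - h) := by
    rw [Real.cos_add]; ring
  rw [h3]
  refine (abs_sub _ _).trans ?_
  rw [abs_mul, abs_mul]
  have := mul_le_mul (Real.abs_cos_le_one u) h2 (abs_nonneg _) zero_le_one
  have := mul_le_mul (Real.abs_sin_le_one u) h1 (abs_nonneg _) zero_le_one
  nlinarith [sq_nonneg h]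

lemma uniformChar_taylor (g : ℕ) (hg : 1 ≤ g) (x : ℝ) :
    ∃ b : ℝ, |b| ≤ g ∧ ∀ h : ℝ, |h| ≤ 1 / g →
      |uniformChar g (x + h) - uniformChar g x - b * h| ≤ (g : ℝ) ^ 2 * h ^ 2 := by
  have hgpos : (0 : ℝ) < g := by positivity
  have hc : ∀ k : Fin g, |((k : ℕ) : ℝ) - ((g : ℝ) - 1) / 2| ≤ g := by
    intro k
    have h1 : (((k : ℕ) : ℝ)) + 1 ≤ g := by exact_mod_cast k.2
    have h2 : (0 : ℝ) ≤ ((k : ℕ) : ℝ) := by positivity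
    rw [abs_le]
    constructor <;> linarith
  refine ⟨(∑ k : Fin g, -Real.sin ((((k : ℕ) : ℝ) - ((g : ℝ) - 1) / 2) * x)
      * (((k : ℕ) : ℝ) - ((g : ℝ) - 1) / 2)) / g, ?_, ?_⟩
  · rw [abs_div, Nat.abs_cast, div_le_iff₀ hgpos]
    refine (Finset.abs_sum_le_sum_abs _ _).trans ?_
    refine (Finset.sum_le_sum (g := fun _ => (g : ℝ)) fun k _ => ?_).trans (by simp)
    rw [abs_mul, abs_neg]
    simpa using mul_le_mul (Real.abs_sin_le_one _) (hc k) (abs_nonneg _) zero_le_one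
  · intro h hh
    have : uniformChar g (x + h) - uniformChar g x
        - (∑ k : Fin g, -Real.sin ((((k : ℕ) : ℝ) - ((g : ℝ) - 1) / 2) * x)
          * (((k : ℕ) : ℝ) - ((g : ℝ) - 1) / 2)) / g * h
        = (∑ k : Fin g, (Real.cos ((((k : ℕ) : ℝ) - ((g : ℝ) - 1) / 2) * x
            + (((k : ℕ) : ℝ) - ((g : ℝ) - 1) / 2) * h)
          - Real.cos ((((k : ℕ) : ℝ) - ((g : ℝ) - 1) / 2) * x)
          - (-Real.sin ((((k : ℕ) : ℝ) - ((g : ℝ) - 1) / 2) * x))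
            * ((((k : ℕ) : ℝ) - ((g : ℝ) - 1) / 2) * h))) / g := by
      rw [Finset.sum_sub_distrib, Finset.sum_sub_distrib, uniformChar, uniformChar]
      simp_rw [mul_add, ← mul_assoc]
      rw [← Finset.sum_mul]
      ring
    rw [this, abs_div, Nat.abs_cast, div_le_iff₀ hgpos]
    refine (Finset.abs_sum_le_sum_abs _ _).trans ?_
    refine (Finset.sum_le_sum (g := fun _ => (g : ℝ) ^ 2 * h ^ 2) fun k _ => ?_).trans
      (by simp [mul_comm])
    have hk : |(((k : ℕ) : ℝ) - ((g : ℝ) - 1) / 2) * h| ≤ 1 := by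
      rw [abs_mul]
      refine (mul_le_mul (hc k) hh (abs_nonneg _) hgpos.le).trans ?_
      rw [mul_one_div_cancel hgpos.ne']
    refine (abs_cos_add_sub_le _ _ hk).trans ?_
    rw [mul_pow]
    refine mul_le_mul_of_nonneg_right ?_ (sq_nonneg h)
    exact sq_le_sq' (abs_le.1 (hc k)).1 (abs_le.1 (hc k)).2

/-- Near `0`, `f` is at most `1` at the origin and is approximated to second order by an affine
function, with explicit bounds stable under multiplication by shifted copies of `uniformChar`. -/
def HasAffineApprox (g : ℕ) (f : ℝ → ℝ) : Prop :=
  |f 0| ≤ 1 ∧ ∃ b : ℝ, |b| ≤ 2 * g ∧ ∀ h : ℝ, |h| ≤ 1 / (12 * g) →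
    |f h - f 0 - b * h| ≤ 10 * (g : ℝ) ^ 2 * h ^ 2

lemma HasAffineApprox.mul_uniformChar {g : ℕ} (hg : 3 ≤ g) {f : ℝ → ℝ}
    (hf : HasAffineApprox g f) {x : ℝ} (hx : |uniformChar g x| = 1 / g) :
    HasAffineApprox g (fun h => f h * uniformChar g (h + x)) := by
  obtain ⟨hf0, b, hb, hfb⟩ := hf
  obtain ⟨b', hb', hψ⟩ := uniformChar_taylor g (by omega) x
  have hg3 : (3 : ℝ) ≤ g := by exact_mod_cast hg
  have hgpos : (0 : ℝ) < g := by linarith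
  have hx3 : |uniformChar g x| ≤ 1 / 3 := by
    rw [hx]
    exact one_div_le_one_div_of_le (by norm_num) hg3
  refine ⟨?_, f 0 * b' + b * uniformChar g x, ?_, ?_⟩
  · rw [abs_mul]
    exact mul_le_one₀ hf0 (abs_nonneg _) (abs_uniformChar_le_one _ _)
  · refine (abs_add_le _ _).trans ?_
    rw [abs_mul, abs_mul]
    have h1 := mul_le_mul hf0 hb' (abs_nonneg _) zero_le_one
    have h2 := mul_le_mul hb hx3 (abs_nonneg _) (by positivity)
    linarith
  · intro h hh
    have hle : 1 / (12 * (g : ℝ)) ≤ 1 / g :=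
      one_div_le_one_div_of_le hgpos (by linarith)
    have hgh : g * |h| ≤ 1 / 12 := by
      refine (mul_le_mul_of_nonneg_left hh hgpos.le).trans_eq ?_
      field_simp
    have hE' := hψ h (hh.trans hle)
    have hE := hfb h hh
    have hsq : (g : ℝ) ^ 2 * h ^ 2 = (g * |h|) ^ 2 := by rw [mul_pow, sq_abs]
    have hlip : |uniformChar g (x + h) - uniformChar g x| ≤ 2 * (g * |h|) := by
      have h1 : uniformChar g (x + h) - uniformChar g x
          = (uniformChar g (x + h) - uniformChar g x - b' * h) + b' * h := by ring
      rw [h1]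
      refine (abs_add_le _ _).trans ?_
      rw [abs_mul]
      have h2 := mul_le_mul_of_nonneg_right hb' (abs_nonneg h)
      have h3 : 0 ≤ g * |h| := by positivity
      rw [hsq] at hE'
      nlinarith
    have hval : |uniformChar g (x + h)| ≤ 1 / 2 := by
      have h1 : uniformChar g (x + h)
          = (uniformChar g (x + h) - uniformChar g x) + uniformChar g x := by ring
      rw [h1]
      refine (abs_add_le _ _).trans ?_
      linarith
    have hid : f h * uniformChar g (h + x) - f 0 * uniformChar g (0 + x)
        - (f 0 * b' + b * uniformChar g x) * h
        = (f h - f 0 - b * h) * uniformChar g (x + h)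
          + f 0 * (uniformChar g (x + h) - uniformChar g x - b' * h)
          + b * h * (uniformChar g (x + h) - uniformChar g x) := by
      rw [zero_add, add_comm h x]
      ring
    rw [hid]
    refine (abs_add_three _ _ _).trans ?_
    rw [abs_mul, abs_mul, abs_mul, abs_mul]
    have h1 := mul_le_mul hE hval (abs_nonneg _) (by positivity)
    have h2 := mul_le_mul hf0 hE' (abs_nonneg _) zero_le_one
    have h3 := mul_le_mul (mul_le_mul_of_nonneg_right hb (abs_nonneg h)) hlip (abs_nonneg _)
      (by positivity)
    have h4 : 2 * (g : ℝ) * |h| * (2 * (g * |h|)) = 4 * (g ^ 2 * h ^ 2) := by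
      rw [hsq]; ring
    rw [h4] at h3
    linarith

lemma HasAffineApprox.prod {g : ℕ} (hg : 3 ≤ g) {ι : Type*} (S : Finset ι) (x : ι → ℝ)
    (n : ι → ℕ) (hx : ∀ i, |uniformChar g (x i)| = 1 / g) :
    HasAffineApprox g (fun h => ∏ i ∈ S, uniformChar g (h + x i) ^ n i) := by
  induction S using Finset.induction_on with
  | empty =>
    refine ⟨by simp, 0, by simp, fun h _ => ?_⟩
    simp
    positivity
  | insert i S hi ih =>
    simp_rw [Finset.prod_insert hi]
    have key : ∀ k : ℕ, HasAffineApprox g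
        (fun h => uniformChar g (h + x i) ^ k * ∏ i ∈ S, uniformChar g (h + x i) ^ n i) := by
      intro k
      induction k with
      | zero => simpa using ih
      | succ k ihk =>
        convert ihk.mul_uniformChar hg (hx i) using 2
        ring
    exact key (n i)

lemma exists_affine_approx_bound (g : ℕ) (hg : 3 ≤ g) :
    ∃ K : ℝ, 0 < K ∧ ∀ f : ℝ → ℝ, HasAffineApprox g f → (∀ h, |f h| ≤ 1) →
      ∃ b : ℝ, ∀ h, |f h - f 0 - b * h| ≤ K * h ^ 2 := by
  have hgpos : (0 : ℝ) < g := by positivity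
  refine ⟨10 * (g : ℝ) ^ 2 + (2 * (12 * g) ^ 2 + 2 * g * (12 * g)), by positivity, ?_⟩
  rintro f ⟨-, b, hb, hfb⟩ hf
  refine ⟨b, fun h => ?_⟩
  rcases le_total |h| (1 / (12 * g)) with hh | hh
  · refine (hfb h hh).trans (mul_le_mul_of_nonneg_right ?_ (sq_nonneg h))
    have : (0 : ℝ) ≤ 2 * (12 * g) ^ 2 + 2 * g * (12 * g) := by positivity
    linarith
  · have h1 : 1 ≤ 12 * g * |h| := by
      rw [div_le_iff₀ (by positivity)] at hh
      linarith
    have h2 : |f h - f 0 - b * h| ≤ 2 + 2 * g * |h| := by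
      refine (abs_sub _ _).trans ?_
      have := abs_sub (f h) (f 0)
      rw [abs_mul]
      have := mul_le_mul_of_nonneg_right hb (abs_nonneg h)
      linarith [hf h, hf 0]
    refine h2.trans ?_
    rw [← sq_abs h]
    have h3 : 1 ≤ (12 * g * |h|) ^ 2 := one_le_pow₀ h1
    have h4 : 2 * g * |h| * 1 ≤ 2 * g * |h| * (12 * g * |h|) :=
      mul_le_mul_of_nonneg_left h1 (by positivity)
    have h5 : (0 : ℝ) ≤ 10 * g ^ 2 * |h| ^ 2 := by positivity
    linarith

lemma integral_sq_mul_exp_le (κ : ℝ) (hκ : 0 < κ) (a : ℕ) (ha : 1 ≤ a) :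
    ∫ x in (-Real.pi)..Real.pi, x ^ 2 * Real.exp (-(κ * a) * x ^ 2)
      ≤ 2 / κ * Real.sqrt (2 * Real.pi / κ) * (a : ℝ) ^ (-(3 : ℝ) / 2) := by
  have ha' : (0 : ℝ) < a := by positivity
  set β := κ * a / 2 with hβ
  have hβpos : 0 < β := by positivity
  have hpi := Real.pi_pos
  have hpt : ∀ x : ℝ, x ^ 2 * Real.exp (-(κ * a) * x ^ 2) ≤ 1 / β * Real.exp (-β * x ^ 2) := by
    intro x
    have h1 : Real.exp (-(κ * a) * x ^ 2) = Real.exp (-β * x ^ 2) * Real.exp (-(β * x ^ 2)) := by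
      rw [← Real.exp_add, hβ]
      ring_nf
    have h2 : β * x ^ 2 * Real.exp (-(β * x ^ 2)) ≤ 1 := by
      rw [Real.exp_neg, ← div_eq_mul_inv, div_le_one (Real.exp_pos _)]
      linarith [Real.add_one_le_exp (β * x ^ 2)]
    rw [h1]
    have h3 : x ^ 2 * (Real.exp (-β * x ^ 2) * Real.exp (-(β * x ^ 2)))
        = 1 / β * Real.exp (-β * x ^ 2) * (β * x ^ 2 * Real.exp (-(β * x ^ 2))) := by
      field_simp
    rw [h3]
    exact mul_le_of_le_one_right (by positivity) h2
  have hint : MeasureTheory.Integrable (fun x : ℝ => 1 / β * Real.exp (-β * x ^ 2)) :=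
    (integrable_exp_neg_mul_sq hβpos).const_mul _
  calc ∫ x in (-Real.pi)..Real.pi, x ^ 2 * Real.exp (-(κ * a) * x ^ 2)
      ≤ ∫ x in (-Real.pi)..Real.pi, 1 / β * Real.exp (-β * x ^ 2) := by
        apply intervalIntegral.integral_mono_on (by linarith)
        · exact Continuous.intervalIntegrable (by fun_prop) _ _
        · exact hint.intervalIntegrable
        · exact fun x _ => hpt x
    _ ≤ ∫ x : ℝ, 1 / β * Real.exp (-β * x ^ 2) := by
        rw [intervalIntegral.integral_of_le (by linarith)]
        exact MeasureTheory.setIntegral_le_integral hint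
          (Filter.Eventually.of_forall fun x => by positivity)
    _ = 1 / β * Real.sqrt (Real.pi / β) := by
        rw [MeasureTheory.integral_const_mul, integral_gaussian]
    _ = 2 / κ * Real.sqrt (2 * Real.pi / κ) * (a : ℝ) ^ (-(3 : ℝ) / 2) := by
        have h1 : Real.pi / β = 2 * Real.pi / κ * (a : ℝ)⁻¹ := by
          rw [hβ]; field_simp
        have h2 : (a : ℝ) ^ (-(3 : ℝ) / 2) = (a : ℝ)⁻¹ * Real.sqrt ((a : ℝ)⁻¹) := by
          rw [Real.sqrt_eq_rpow, Real.inv_rpow ha'.le, ← Real.rpow_neg ha'.le,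
            ← Real.rpow_neg_one, ← Real.rpow_add ha']
          norm_num
        rw [h1, h2, Real.sqrt_mul (by positivity), hβ]
        field_simp

lemma abs_integral_uniformChar_pow_mul_le (g : ℕ) (hg : 3 ≤ g) (f : ℝ → ℝ) (hf : Continuous f)
    (b K : ℝ) (hK : 0 ≤ K) (hfb : ∀ h, |f h - f 0 - b * h| ≤ K * h ^ 2) (a : ℕ) (ha : 1 ≤ a) :
    |∫ x in (-Real.pi)..Real.pi, uniformChar g x ^ a * f x|
      ≤ 2 * Real.pi * |f 0| + K * (2 / (1 / (g * Real.pi ^ 2))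
        * Real.sqrt (2 * Real.pi / (1 / (g * Real.pi ^ 2))) * (a : ℝ) ^ (-(3 : ℝ) / 2)) := by
  have hpi := Real.pi_pos
  have hc := continuous_uniformChar g
  have hodd : ∫ x in (-Real.pi)..Real.pi, uniformChar g x ^ a * (b * x) = 0 := by
    have h := intervalIntegral.integral_comp_neg (a := -Real.pi) (b := Real.pi)
      (fun x => uniformChar g x ^ a * (b * x))
    simp only [uniformChar_neg, neg_neg, mul_neg, intervalIntegral.integral_neg] at h
    linarith
  have hsplit : ∫ x in (-Real.pi)..Real.pi, uniformChar g x ^ a * f x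
      = (∫ x in (-Real.pi)..Real.pi, uniformChar g x ^ a * f 0)
        + (∫ x in (-Real.pi)..Real.pi, uniformChar g x ^ a * (b * x))
        + ∫ x in (-Real.pi)..Real.pi, uniformChar g x ^ a * (f x - f 0 - b * x) := by
    rw [← intervalIntegral.integral_add, ← intervalIntegral.integral_add]
    · congr 1
      ext x
      ring
    all_goals exact Continuous.intervalIntegrable (by fun_prop) _ _
  rw [hsplit, hodd, add_zero]
  refine (abs_add_le _ _).trans (add_le_add ?_ ?_)
  · have := intervalIntegral.norm_integral_le_of_norm_le_const (a := -Real.pi) (b := Real.pi)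
      (f := fun x => uniformChar g x ^ a * f 0) (C := |f 0|) (fun x _ => by
        rw [Real.norm_eq_abs, abs_mul, abs_pow]
        exact mul_le_of_le_one_left (abs_nonneg _)
          (pow_le_one₀ (abs_nonneg _) (abs_uniformChar_le_one _ _)))
    rw [Real.norm_eq_abs] at this
    refine this.trans_eq ?_
    rw [sub_neg_eq_add, abs_of_pos (by linarith : 0 < Real.pi + Real.pi)]
    ring
  · refine le_trans ?_ (mul_le_mul_of_nonneg_left
      (integral_sq_mul_exp_le (1 / (g * Real.pi ^ 2)) (by positivity) a ha) hK)
    rw [← intervalIntegral.integral_const_mul, ← Real.norm_eq_abs]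
    refine intervalIntegral.norm_integral_le_of_norm_le (by linarith)
      (Filter.Eventually.of_forall fun x hx => ?_)
      (Continuous.intervalIntegrable (by fun_prop) _ _)
    rw [Real.norm_eq_abs, abs_mul, abs_pow]
    have hx' : |x| ≤ Real.pi := abs_le.2 ⟨hx.1.le, hx.2⟩
    have h1 := pow_le_pow_left₀ (abs_nonneg _) (abs_uniformChar_le_exp g (by omega) x hx') a
    rw [← Real.exp_nat_mul] at h1
    refine (mul_le_mul h1 (hfb x) (abs_nonneg _) (Real.exp_pos _).le).trans_eq ?_
    rw [show (a : ℝ) * (-(1 / (g * Real.pi ^ 2)) * x ^ 2)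
      = -(1 / (g * Real.pi ^ 2) * a) * x ^ 2 by ring]
    ring

lemma abs_integral_four_pi_le (H : ℝ → ℝ) (hH : Continuous H) (ε : ℝ) (hε : ε ^ 2 = 1)
    (hper : ∀ x, H (x + 2 * Real.pi) = ε * H x) :
    |∫ x in (-(2 * Real.pi))..(2 * Real.pi), H x| ≤ 2 * |∫ x in (-Real.pi)..Real.pi, H x| := by
  have hP : Function.Periodic H (4 * Real.pi) := by
    intro x
    rw [show x + 4 * Real.pi = (x + 2 * Real.pi) + 2 * Real.pi by ring, hper, hper, ← mul_assoc,
      ← sq, hε, one_mul]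
  have h1 := hP.intervalIntegral_add_eq (-(2 * Real.pi)) (-Real.pi)
  rw [show -(2 * Real.pi) + 4 * Real.pi = 2 * Real.pi by ring,
    show -Real.pi + 4 * Real.pi = 3 * Real.pi by ring] at h1
  have h2 : ∫ x in Real.pi..(3 * Real.pi), H x = ε * ∫ x in (-Real.pi)..Real.pi, H x := by
    rw [← intervalIntegral.integral_const_mul]
    simp_rw [← hper]
    rw [intervalIntegral.integral_comp_add_right H (2 * Real.pi)]
    congr 1 <;> ring
  rw [h1, ← intervalIntegral.integral_add_adjacent_intervals (b := Real.pi)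
    (hH.intervalIntegrable _ _) (hH.intervalIntegrable _ _), h2]
  have hε' : |ε| = 1 := by
    rcases mul_self_eq_one_iff.1 ((sq ε).symm.trans hε) with rfl | rfl <;> simp
  refine (abs_add_le _ _).trans ?_
  rw [abs_mul, hε']
  linarith

/-- The product of the factors of the Fourier transform of `Ψ` with index `s ≥ 1`. -/
def shiftedProd (g : ℕ) (a : ℕ → ℕ) (x : ℝ) : ℝ :=
  ∏ t : Fin (g - 2), uniformChar g
    (x + 2 * Real.pi * ((t : ℕ) + 1 : ℕ) / ((g : ℝ) - 1)) ^ a ((t : ℕ) + 1)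

lemma continuous_shiftedProd (g : ℕ) (a : ℕ → ℕ) : Continuous (shiftedProd g a) := by
  unfold shiftedProd
  have := continuous_uniformChar g
  fun_prop

lemma abs_shiftedProd_le_one (g : ℕ) (a : ℕ → ℕ) (x : ℝ) : |shiftedProd g a x| ≤ 1 := by
  rw [shiftedProd, Finset.abs_prod]
  refine Finset.prod_le_one (fun _ _ => abs_nonneg _) fun t _ => ?_
  rw [abs_pow]
  exact pow_le_one₀ (abs_nonneg _) (abs_uniformChar_le_one _ _)

lemma shiftedProd_add_two_pi (g : ℕ) (hg : 1 ≤ g) (a : ℕ → ℕ) (x : ℝ) :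
    shiftedProd g a (x + 2 * Real.pi)
      = (∏ t : Fin (g - 2), ((-1 : ℝ) ^ (g - 1)) ^ a ((t : ℕ) + 1)) * shiftedProd g a x := by
  rw [shiftedProd, shiftedProd, ← Finset.prod_mul_distrib]
  refine Finset.prod_congr rfl fun t _ => ?_
  rw [add_right_comm, uniformChar_add_two_pi hg, mul_pow]

lemma abs_shiftedProd_zero_le (g : ℕ) (hg : 3 ≤ g) (a : ℕ → ℕ) (t : ℕ) (h1 : 1 ≤ t)
    (h2 : t ≤ g - 2) : |shiftedProd g a 0| ≤ ((g : ℝ) ^ a t)⁻¹ := by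
  have hg1 : (1 : ℝ) ≤ g := by exact_mod_cast (by omega : 1 ≤ g)
  rw [shiftedProd, Finset.abs_prod]
  have hval : ∀ s : Fin (g - 2), |uniformChar g
      (0 + 2 * Real.pi * ((s : ℕ) + 1 : ℕ) / ((g : ℝ) - 1)) ^ a ((s : ℕ) + 1)|
      = ((g : ℝ) ^ a ((s : ℕ) + 1))⁻¹ := by
    intro s
    rw [zero_add, abs_pow, abs_uniformChar_root_of_unity g (by omega) _ (by omega) (by omega),
      one_div, inv_pow]
  simp_rw [hval]
  rw [← Finset.mul_prod_erase _ _ (Finset.mem_univ (⟨t - 1, by omega⟩ : Fin (g - 2)))]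
  simp only [Nat.sub_add_cancel h1]
  refine mul_le_of_le_one_right (by positivity) (Finset.prod_le_one (fun _ _ => by positivity) ?_)
  exact fun s _ => inv_le_one_of_one_le₀ (one_le_pow₀ hg1)

lemma norm_Psi_le (g : ℕ) (hg : 1 ≤ g) (a : ℕ → ℕ) :
    2 * Real.pi * ‖Psi g a 0‖
      ≤ |∫ x in (-Real.pi)..Real.pi, uniformChar g x ^ a 0 * shiftedProd g a x| := by
  have hpi := Real.pi_pos
  have h := congrArg norm (Psi_eq_integral_s13 g hg a)
  rw [Complex.norm_real, Real.norm_eq_abs, norm_mul, norm_mul, Complex.norm_real,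
    Real.norm_eq_abs, abs_of_pos hpi, Complex.norm_ofNat] at h
  have hc := continuous_uniformChar g
  have hs := continuous_shiftedProd g a
  have hsgn : ∀ n : ℕ, (((-1 : ℝ) ^ (g - 1)) ^ n) ^ 2 = 1 := by
    intro n
    rw [← pow_mul, ← pow_mul]
    exact Even.neg_one_pow ⟨(g - 1) * n, by ring⟩
  have h4 := abs_integral_four_pi_le (fun x => uniformChar g x ^ a 0 * shiftedProd g a x)
    (by fun_prop)
    (((-1 : ℝ) ^ (g - 1)) ^ a 0 * ∏ t : Fin (g - 2), ((-1 : ℝ) ^ (g - 1)) ^ a ((t : ℕ) + 1))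
    (by
      rw [mul_pow, hsgn, ← Finset.prod_pow]
      simp only [hsgn, Finset.prod_const_one, mul_one])
    (fun x => by
      rw [uniformChar_add_two_pi hg, shiftedProd_add_two_pi g hg, mul_pow]
      ring)
  simp only [shiftedProd] at h4 ⊢
  linarith

theorem statement13 (g : ℕ) (hg : 3 ≤ g) (C : ℝ) (hC : 0 < C) :
    ∃ c : ℝ, 0 < c ∧ ∀ a : ℕ → ℕ, 1 ≤ a 0 →
      (∀ i : ℕ, i ≤ g - 2 → a i ≤ a 0) →
      ∀ m : ℕ, (m : ℝ) ≤ C * (a 0 : ℝ) ^ ((1 : ℝ) / 4) →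
      ∀ t : ℕ, 1 ≤ t → t ≤ g - 2 →
        ‖Psi g (Function.update a t (a t + m)) 0‖ ≤
          ((g : ℝ) ^ m)⁻¹ + c * (m : ℝ) ^ 2 * (a 0 : ℝ) ^ (-(3 : ℝ) / 2) := by
  have hpi := Real.pi_pos
  have hgpos : (0 : ℝ) < g := by positivity
  obtain ⟨K, hK, hKf⟩ := exists_affine_approx_bound g hg
  set A := 2 / (1 / (g * Real.pi ^ 2)) * Real.sqrt (2 * Real.pi / (1 / (g * Real.pi ^ 2))) with hA
  have hApos : 0 < A := by positivity
  refine ⟨K * A / (2 * Real.pi), by positivity, ?_⟩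
  intro a ha _ m _ t ht1 ht2
  set a' := Function.update a t (a t + m) with ha'
  have ha0 : a' 0 = a 0 := Function.update_of_ne (by omega) _ _
  have hat : a' t = a t + m := Function.update_self _ _ _
  have hle := norm_Psi_le g (by omega) a'
  rcases Nat.eq_zero_or_pos m with rfl | hm
  · have hb := intervalIntegral.norm_integral_le_of_norm_le_const (a := -Real.pi) (b := Real.pi)
      (f := fun x => uniformChar g x ^ a' 0 * shiftedProd g a' x) (C := 1) (fun x _ => by
        rw [Real.norm_eq_abs, abs_mul, abs_pow]
        exact mul_le_one₀ (pow_le_one₀ (abs_nonneg _) (abs_uniformChar_le_one _ _))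
          (abs_nonneg _) (abs_shiftedProd_le_one _ _ _))
    rw [Real.norm_eq_abs, sub_neg_eq_add, abs_of_pos (by linarith : 0 < Real.pi + Real.pi)] at hb
    have : ‖Psi g a' 0‖ ≤ 1 := by nlinarith
    simpa using this
  · have happ : HasAffineApprox g (shiftedProd g a') := by
      have := HasAffineApprox.prod hg Finset.univ
        (fun s : Fin (g - 2) => 2 * Real.pi * ((s : ℕ) + 1 : ℕ) / ((g : ℝ) - 1))
        (fun s => a' ((s : ℕ) + 1))
        (fun s => abs_uniformChar_root_of_unity g (by omega) _ (by omega) (by omega))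
      exact this
    obtain ⟨b, hb⟩ := hKf _ happ (abs_shiftedProd_le_one g a')
    have hI := abs_integral_uniformChar_pow_mul_le g hg _ (continuous_shiftedProd g a') b K hK.le
      hb (a' 0) (by omega)
    have h0 : |shiftedProd g a' 0| ≤ ((g : ℝ) ^ m)⁻¹ := by
      refine (abs_shiftedProd_zero_le g hg a' t ht1 ht2).trans ?_
      refine inv_anti₀ (by positivity) (pow_le_pow_right₀ ?_ (by omega))
      exact_mod_cast (by omega : 1 ≤ g)
    rw [← hA, ha0] at hI
    rw [ha0] at hle
    set R := (a 0 : ℝ) ^ (-(3 : ℝ) / 2) with hR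
    have hRnn : 0 ≤ R := by positivity
    have hm2 : (1 : ℝ) ≤ (m : ℝ) ^ 2 := one_le_pow₀ (by exact_mod_cast hm)
    have h1 : 2 * Real.pi * ‖Psi g a' 0‖
        ≤ 2 * Real.pi * (((g : ℝ) ^ m)⁻¹ + K * A / (2 * Real.pi) * R) := by
      have h3 := mul_le_mul_of_nonneg_left h0 (by positivity : (0 : ℝ) ≤ 2 * Real.pi)
      have h4 : 2 * Real.pi * (K * A / (2 * Real.pi) * R) = K * (A * R) := by field_simp
      rw [mul_add, h4]
      linarith
    have h2 := le_of_mul_le_mul_left h1 (by positivity)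
    refine h2.trans ?_
    have h5 : K * A / (2 * Real.pi) * R ≤ K * A / (2 * Real.pi) * (m : ℝ) ^ 2 * R :=
      mul_le_mul_of_nonneg_right (le_mul_of_one_le_right (by positivity) hm2) hRnn
    linarith
end
end
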